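/- arXiv:1708.09664 — 3 statements merged into one kernel-verified Lean document; each statement's English description precedes it below -/
import Mathlib

section
/- Harnack principle: Let b be a connected graph over X, q : X → ℝ a potential, and f : X → ℝ. Let (u_n) be a sequence of positive functions in F(X) with Hu_n ≥ f·u_n on X, and suppose there are o ∈ X and C > 0 with C⁻¹ ≤ u_n(o) ≤ C for all n. Then there exists a subsequence (u_{n_k}) converging pointwise to a strictly positive function u ∈ F(X) satisfying Hu ≥ f·u on X. If moreover the subsequence is monotone increasing, or is dominated by some g ∈ F(X), or the graph is locally finite, then Hu_{n_k}(x) → Hu(x) for every x ∈ X. -/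
open Filter Topology

variable {X : Type*}

/-- A graph over `X`: symmetric, nonnegative, zero diagonal, locally summable. -/
def IsGraph (b : X → X → ℝ) : Prop :=
  (∀ x y, 0 ≤ b x y) ∧ (∀ x y, b x y = b y x) ∧ (∀ x, b x x = 0) ∧
    ∀ x, Summable fun y => b x y

/-- Connectedness of the graph `b`: any two vertices are joined by a path of
adjacent vertices. -/
def GraphConnected (b : X → X → ℝ) : Prop :=
  ∀ x y : X, ∃ (n : ℕ) (p : ℕ → X), p 0 = x ∧ p n = y ∧ ∀ i < n, 0 < b (p i) (p (i + 1))

/-- A set `W` is connected in the graph `b` if any two of its points are joined by a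
path of adjacent vertices lying in `W`. -/
def ConnectedIn (b : X → X → ℝ) (W : Set X) : Prop :=
  ∀ x ∈ W, ∀ y ∈ W, ∃ (n : ℕ) (p : ℕ → X), p 0 = x ∧ p n = y ∧
    (∀ i ≤ n, p i ∈ W) ∧ ∀ i < n, 0 < b (p i) (p (i + 1))

/-- Local finiteness of the graph `b`. -/
def LocFin (b : X → X → ℝ) : Prop := ∀ x, {y | 0 < b x y}.Finite

/-- Membership in `F(X)`, the functions against which `b` is summable. -/
def MemF (b : X → X → ℝ) (f : X → ℝ) : Prop :=
  ∀ x, Summable fun y => b x y * |f y|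

/-- The formal Schrödinger operator `H = L + q`. -/
noncomputable def Hop (b : X → X → ℝ) (q : X → ℝ) (f : X → ℝ) (x : X) : ℝ :=
  (∑' y, b x y * (f x - f y)) + q x * f x

/-- Membership in `C_c(X)`: finitely supported functions. -/
def FinSupp (φ : X → ℝ) : Prop := (Function.support φ).Finite

/-- The energy form `h` associated with `b` and `q`, evaluated on `C_c(X)`. -/
noncomputable def hform (b : X → X → ℝ) (q : X → ℝ) (φ : X → ℝ) : ℝ :=
  (1 / 2) * (∑' p : X × X, b p.1 p.2 * (φ p.1 - φ p.2) ^ 2) + ∑' x, q x * φ x ^ 2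

/-- The form `h` is subcritical in `X`. -/
def Subcritical (b : X → X → ℝ) (q : X → ℝ) : Prop :=
  ∃ w : X → ℝ, (∀ x, 0 ≤ w x) ∧ w ≠ 0 ∧
    ∀ φ : X → ℝ, FinSupp φ → (∑' x, w x * φ x ^ 2) ≤ hform b q φ

/-- The capacity of the singleton `{x}` with respect to the form `h`. -/
noncomputable def capH (b : X → X → ℝ) (q : X → ℝ) (x : X) : ℝ :=
  sInf {r : ℝ | ∃ φ : X → ℝ, FinSupp φ ∧ φ x = 1 ∧ r = hform b q φ}

/-- The extended (extended-real-valued) energy of the weighted Laplacian part. -/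
noncomputable def hExt (b : X → X → ℝ) (f : X → ℝ) : ENNReal :=
  (∑' p : X × X, ENNReal.ofReal (b p.1 p.2 * (f p.1 - f p.2) ^ 2)) / 2

lemma GraphConnected.induction {b : X → X → ℝ} (hconn : GraphConnected b) {P : X → Prop} {o : X}
    (ho : P o) (hstep : ∀ x y, 0 < b x y → P x → P y) (y : X) : P y := by
  obtain ⟨n, p, hp0, hpn, hp⟩ := hconn o y
  have key : ∀ i ≤ n, P (p i) := by
    intro i
    induction i with
    | zero => intro _; rwa [hp0]
    | succ i ih => intro hi; exact hstep _ _ (hp i (by lia)) (ih (by lia))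
  exact hpn ▸ key n le_rfl

lemma GraphConnected.countable {b : X → X → ℝ} (hb : IsGraph b) (hconn : GraphConnected b) (o : X) :
    Countable X := by
  let S : ℕ → Set X := fun n => Nat.rec {o} (fun _ s => ⋃ x ∈ s, {y | 0 < b x y}) n
  have hS : ∀ n, (S n).Countable := by
    intro n
    induction n with
    | zero => exact Set.countable_singleton o
    | succ n ih =>
      refine ih.biUnion fun x _ => (hb.2.2.2 x).countable_support.mono ?_
      intro y hy
      exact ne_of_gt hy
  have hcover : ∀ y, y ∈ ⋃ n, S n := by
    refine hconn.induction (o := o) (Set.mem_iUnion.2 ⟨0, rfl⟩) ?_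
    intro x y hxy hx
    obtain ⟨n, hn⟩ := Set.mem_iUnion.1 hx
    exact Set.mem_iUnion.2 ⟨n + 1, Set.mem_biUnion hn hxy⟩
  refine Set.countable_univ_iff.1 ((Set.countable_iUnion hS).mono fun y _ => hcover y)

lemma MemF.summable {b : X → X → ℝ} (hb : IsGraph b) {w : X → ℝ} (hw : MemF b w) (x : X) :
    Summable fun y => b x y * w y := by
  refine Summable.of_norm ((hw x).congr fun y => ?_)
  rw [Real.norm_eq_abs, abs_mul, abs_of_nonneg (hb.1 x y)]

lemma MemF.Hop_eq {b : X → X → ℝ} (hb : IsGraph b) (q : X → ℝ) {w : X → ℝ} (hw : MemF b w) (x : X) :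
    Hop b q w x = ((∑' y, b x y) + q x) * w x - ∑' y, b x y * w y := by
  have h : ∑' y, b x y * (w x - w y) = (∑' y, b x y) * w x - ∑' y, b x y * w y := by
    rw [← tsum_mul_right, ← ((hb.2.2.2 x).mul_right _).tsum_sub (hw.summable hb x)]
    exact tsum_congr fun y => by ring
  rw [Hop, h]
  ring

/-- The supersolution inequality `f w ≤ H w` bounds the weighted sum of `w` over the neighbors. -/
lemma MemF.le_Hop_iff {b : X → X → ℝ} (hb : IsGraph b) (q f : X → ℝ) {w : X → ℝ} (hw : MemF b w)
    (x : X) :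
    f x * w x ≤ Hop b q w x ↔ ∑' y, b x y * w y ≤ ((∑' y, b x y) + q x - f x) * w x := by
  rw [hw.Hop_eq hb]
  constructor <;> intro h <;> linarith

/-- Harnack inequality for nonnegative supersolutions. -/
lemma harnack_inequality {b : X → X → ℝ} (hb : IsGraph b) (hconn : GraphConnected b) (q f : X → ℝ)
    (o x : X) :
    ∃ K > 0, ∀ w : X → ℝ, MemF b w → (∀ y, 0 ≤ w y) → (∀ y, f y * w y ≤ Hop b q w y) →
      w x ≤ K * w o ∧ w o ≤ K * w x := by
  have hnbr : ∀ x y, 0 < b x y → ∃ K > 0, ∀ w : X → ℝ, MemF b w → (∀ y, 0 ≤ w y) →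
      (∀ y, f y * w y ≤ Hop b q w y) → w y ≤ K * w x := by
    intro x y hxy
    set D := (∑' y, b x y) + q x - f x with hD
    refine ⟨|D| / b x y + 1, by positivity, fun w hw hpos hsup => ?_⟩
    have h1 := (hw.summable hb x).le_tsum y fun z _ => mul_nonneg (hb.1 x z) (hpos z)
    have h2 := (hw.le_Hop_iff hb q f x).1 (hsup x)
    have h3 : b x y * w y ≤ |D| * w x :=
      (h1.trans h2).trans (mul_le_mul_of_nonneg_right (le_abs_self D) (hpos x))
    have h4 : w y ≤ |D| * w x / b x y := (le_div_iff₀' hxy).2 h3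
    have h5 : (|D| / b x y + 1) * w x = |D| * w x / b x y + w x := by ring
    linarith [hpos x]
  revert x
  refine hconn.induction (o := o) ⟨1, one_pos, fun w _ _ _ => by simp⟩ ?_
  rintro y z hyz ⟨K, hK, hKw⟩
  obtain ⟨A, hA, hAw⟩ := hnbr y z hyz
  obtain ⟨B, hB, hBw⟩ := hnbr z y (hb.2.1 y z ▸ hyz)
  refine ⟨A * K + K * B, by positivity, fun w hw hpos hsup => ?_⟩
  obtain ⟨h1, h2⟩ := hKw w hw hpos hsup
  have h3 := mul_le_mul_of_nonneg_left h1 hA.le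
  have h4 := mul_le_mul_of_nonneg_left (hBw w hw hpos hsup) hK.le
  have h5 : 0 ≤ K * B * w o := mul_nonneg (by positivity) (hpos o)
  have h6 : 0 ≤ A * K * w z := mul_nonneg (by positivity) (hpos z)
  constructor <;> linarith [hAw w hw hpos hsup]

/-- Fatou's lemma for supersolutions. -/
lemma supersolution_of_tendsto {b : X → X → ℝ} (hb : IsGraph b) (q f : X → ℝ) {w : ℕ → X → ℝ}
    {v : X → ℝ} (hwF : ∀ n, MemF b (w n)) (hpos : ∀ n x, 0 ≤ w n x)
    (hsuper : ∀ n x, f x * w n x ≤ Hop b q (w n) x)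
    (hlim : ∀ x, Tendsto (fun n => w n x) atTop (𝓝 (v x))) :
    MemF b v ∧ ∀ x, f x * v x ≤ Hop b q v x := by
  have hv : ∀ x, 0 ≤ v x := fun x => ge_of_tendsto' (hlim x) fun n => hpos n x
  have hsum : ∀ x (s : Finset X),
      ∑ y ∈ s, b x y * v y ≤ ((∑' y, b x y) + q x - f x) * v x := by
    intro x s
    refine le_of_tendsto_of_tendsto' (tendsto_finsetSum s fun y _ => (hlim y).const_mul (b x y))
      ((hlim x).const_mul _) fun n => ?_
    exact (((hwF n).summable hb x).sum_le_tsum s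
      fun y _ => mul_nonneg (hb.1 x y) (hpos n y)).trans (((hwF n).le_Hop_iff hb q f x).1 (hsuper n x))
  have hvs : ∀ x, Summable fun y => b x y * v y := fun x =>
    summable_of_sum_le (fun y => mul_nonneg (hb.1 x y) (hv y)) (hsum x)
  have hvF : MemF b v := fun x => (hvs x).congr fun y => by rw [abs_of_nonneg (hv y)]
  exact ⟨hvF, fun x => (hvF.le_Hop_iff hb q f x).2 ((hvs x).tsum_le_of_sum_le (hsum x))⟩

/-- Dominated convergence for the Schrödinger operator at a vertex. -/
lemma tendsto_Hop_of_dominated {b : X → X → ℝ} (hb : IsGraph b) (q : X → ℝ) {w : ℕ → X → ℝ}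
    {v g : X → ℝ} (hwF : ∀ n, MemF b (w n)) (hvF : MemF b v) (hpos : ∀ n x, 0 ≤ w n x)
    (hlim : ∀ x, Tendsto (fun n => w n x) atTop (𝓝 (v x))) (hle : ∀ n x, w n x ≤ g x) (x : X)
    (hg : Summable fun y => b x y * g y) :
    Tendsto (fun n => Hop b q (w n) x) atTop (𝓝 (Hop b q v x)) := by
  simp only [(hwF _).Hop_eq hb, hvF.Hop_eq hb]
  refine ((hlim x).const_mul _).sub ?_
  refine tendsto_tsum_of_dominated_convergence hg (fun y => (hlim y).const_mul (b x y))
    (Eventually.of_forall fun n y => ?_)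
  rw [Real.norm_of_nonneg (mul_nonneg (hb.1 x y) (hpos n y))]
  exact mul_le_mul_of_nonneg_left (hle n y) (hb.1 x y)

/-- Harnack principle. -/
theorem harnack_principle (b : X → X → ℝ) (q : X → ℝ) (hb : IsGraph b)
    (hconn : GraphConnected b) (f : X → ℝ) (u : ℕ → X → ℝ)
    (huF : ∀ n, MemF b (u n)) (hupos : ∀ n x, 0 ≤ u n x) (hune : ∀ n, u n ≠ 0)
    (hsuper : ∀ n x, f x * u n x ≤ Hop b q (u n) x)
    (o : X) (C : ℝ) (hC : 0 < C) (hbound : ∀ n, C⁻¹ ≤ u n o ∧ u n o ≤ C) :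
    ∃ (φ : ℕ → ℕ) (v : X → ℝ), StrictMono φ ∧ MemF b v ∧ (∀ x, 0 < v x) ∧
      (∀ x, f x * v x ≤ Hop b q v x) ∧
      (∀ x, Tendsto (fun k => u (φ k) x) atTop (nhds (v x))) ∧
      (((∀ k x, u (φ k) x ≤ u (φ (k + 1)) x) ∨
          (∃ g : X → ℝ, MemF b g ∧ ∀ k x, u (φ k) x ≤ g x) ∨ LocFin b) →
        ∀ x, Tendsto (fun k => Hop b q (u (φ k)) x) atTop (nhds (Hop b q v x))) := by
  have hcount : Countable X := hconn.countable hb o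
  choose K hK hKw using harnack_inequality hb hconn q f o
  have hle : ∀ n x, u n x ≤ K x * C := fun n x =>
    (hKw x (u n) (huF n) (hupos n) (hsuper n)).1.trans
      (mul_le_mul_of_nonneg_left (hbound n).2 (hK x).le)
  have hge : ∀ n x, C⁻¹ / K x ≤ u n x := fun n x =>
    (div_le_iff₀' (hK x)).2
      ((hbound n).1.trans (hKw x (u n) (huF n) (hupos n) (hsuper n)).2)
  obtain ⟨v, hv, φ, hφ, hlim⟩ := (isCompact_univ_pi fun x =>
    isCompact_Icc (a := C⁻¹ / K x) (b := K x * C)).tendsto_subseq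
      (x := u) fun n x _ => ⟨hge n x, hle n x⟩
  have hlim' : ∀ x, Tendsto (fun k => u (φ k) x) atTop (𝓝 (v x)) := tendsto_pi_nhds.1 hlim
  obtain ⟨hvF, hvsuper⟩ := supersolution_of_tendsto hb q f (fun k => huF (φ k))
    (fun k => hupos (φ k)) (fun k => hsuper (φ k)) hlim'
  refine ⟨φ, v, hφ, hvF, fun x => (div_pos (inv_pos.2 hC) (hK x)).trans_le
    (hv x (Set.mem_univ x)).1, hvsuper, hlim', fun hcase x => ?_⟩
  have hdom : ∀ g : X → ℝ, (∀ k y, u (φ k) y ≤ g y) → (Summable fun y => b x y * g y) →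
      Tendsto (fun k => Hop b q (u (φ k)) x) atTop (𝓝 (Hop b q v x)) := fun g hg hgs =>
    tendsto_Hop_of_dominated hb q (fun k => huF (φ k)) hvF (fun k => hupos (φ k)) hlim' hg x hgs
  rcases hcase with hmono | ⟨g, hgF, hg⟩ | hfin
  · exact hdom v (fun k y => (monotone_nat_of_le_succ fun k => hmono k y).ge_of_tendsto (hlim' y) k)
      (hvF.summable hb x)
  · exact hdom g hg (hgF.summable hb x)
  · refine hdom (fun y => K y * C) (fun k => hle (φ k))
      (summable_of_hasFiniteSupport ((hfin x).subset fun y hy => ?_))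
    exact (hb.1 x y).lt_of_ne' (left_ne_zero_of_mul hy)
end

section
/- Easy direction of the Allegretto–Piepenbrink theorem: Let b be a connected graph over X, q : X → ℝ a potential, m : X → (0,∞), and λ ∈ ℝ. If there exists a positive u ∈ F(X) with Hu ≥ λ·m·u on X, then h(φ) ≥ λ ∑_{x∈X} m(x)φ(x)² for all φ ∈ C_c(X). -/
open Filter Topology

variable {X : Type*}

/-- A function on `X × X` whose slices are summable and which vanishes outside finitely many
slices is summable. -/
lemma summable_prod_of_finite_support_left {F : X × X → ℝ} {s : Set X} (hs : s.Finite)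
    (hF : ∀ x ∉ s, ∀ y, F (x, y) = 0) (hsum : ∀ x, Summable fun y => F (x, y)) :
    Summable F := by
  rw [← summable_abs_iff, summable_prod_of_nonneg (fun _ => abs_nonneg _)]
  refine ⟨fun x => (hsum x).abs, summable_of_hasFiniteSupport (hs.subset fun x hx => ?_)⟩
  by_contra hxs
  exact hx (by simp [hF x hxs])

lemma FinSupp.summable_mul_sq {φ : X → ℝ} (hφ : FinSupp φ) (c : X → ℝ) :
    Summable fun x => c x * φ x ^ 2 := by
  refine summable_of_hasFiniteSupport (hφ.subset fun x hx => ?_)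
  rintro h
  exact hx (by simp [h])

lemma MemF.summable_mul {b : X → X → ℝ} {u : X → ℝ} (hb : IsGraph b) (hu : MemF b u) (x : X) :
    Summable fun y => b x y * u y := by
  rw [← summable_abs_iff]
  simpa [abs_mul, abs_of_nonneg (hb.1 x _)] using hu x

lemma MemF.summable_mul_sub {b : X → X → ℝ} {u : X → ℝ} (hb : IsGraph b) (hu : MemF b u)
    (x : X) : Summable fun y => b x y * (u x - u y) := by
  simpa only [mul_sub] using ((hb.2.2.2 x).mul_right (u x)).sub (hu.summable_mul hb x)

/-- The strong minimum principle: a nonnegative supersolution which vanishes at a vertex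
vanishes at all neighbours of this vertex. -/
lemma eq_zero_of_adj_of_supersolution {b : X → X → ℝ} {q u : X → ℝ} (hb : IsGraph b)
    (hu : MemF b u) (hupos : ∀ x, 0 ≤ u x) {x y : X} (hx : u x = 0)
    (hH : 0 ≤ Hop b q u x) (hxy : 0 < b x y) : u y = 0 := by
  have hle : b x y * u y ≤ ∑' z, b x z * u z :=
    (hu.summable_mul hb x).le_tsum y fun z _ => mul_nonneg (hb.1 x z) (hupos z)
  simp only [Hop, hx, zero_sub, mul_neg, mul_zero, add_zero, tsum_neg] at hH
  exact le_antisymm (by nlinarith) (hupos y)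

/-- A nonnegative, nontrivial supersolution on a connected graph is strictly positive. -/
lemma pos_of_supersolution {b : X → X → ℝ} {q u c : X → ℝ} (hb : IsGraph b)
    (hconn : GraphConnected b) (hu : MemF b u) (hupos : ∀ x, 0 ≤ u x) (hune : u ≠ 0)
    (hsuper : ∀ x, c x * u x ≤ Hop b q u x) (x : X) : 0 < u x := by
  refine lt_of_le_of_ne (hupos x) fun hx => hune (funext fun y => ?_)
  obtain ⟨n, p, rfl, rfl, hp⟩ := hconn x y
  have key : ∀ i ≤ n, u (p i) = 0 := by
    intro i
    induction i with
    | zero => exact fun _ => hx.symm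
    | succ i ih =>
      intro hi
      have h0 := ih (by omega)
      refine eq_zero_of_adj_of_supersolution (q := q) hb hu hupos h0 ?_ (hp i (by omega))
      simpa [h0] using hsuper (p i)
  exact key n le_rfl

lemma sub_mul_sq_div_sub_sq_div_le {s t : ℝ} (hs : 0 < s) (ht : 0 < t) (a c : ℝ) :
    (s - t) * (a ^ 2 / s - c ^ 2 / t) ≤ (a - c) ^ 2 := by
  have h : (a - c) ^ 2 - (s - t) * (a ^ 2 / s - c ^ 2 / t) = (a * t - c * s) ^ 2 / (s * t) := by
    field_simp
    ring
  have : 0 ≤ (a * t - c * s) ^ 2 / (s * t) := by positivity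
  linarith

lemma summable_energy {b : X → X → ℝ} (hb : IsGraph b) {φ : X → ℝ} (hφ : FinSupp φ) :
    Summable fun p : X × X => b p.1 p.2 * (φ p.1 - φ p.2) ^ 2 := by
  have h1 : Summable fun p : X × X => b p.1 p.2 * φ p.1 ^ 2 := by
    refine summable_prod_of_finite_support_left (s := Function.support φ) hφ
      (fun x hx y => ?_) fun x => (hb.2.2.2 x).mul_right (φ x ^ 2)
    simp [Function.notMem_support.1 hx]
  have h2 : Summable fun p : X × X => b p.1 p.2 * φ p.2 ^ 2 := by
    refine ((Equiv.prodComm X X).summable_iff.2 h1).congr fun p => ?_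
    simp [hb.2.1 p.1 p.2]
  refine Summable.of_nonneg_of_le (fun p => mul_nonneg (hb.1 _ _) (sq_nonneg _)) (fun p => ?_)
    ((h1.add h2).mul_left 2)
  nlinarith [mul_nonneg (hb.1 p.1 p.2) (sq_nonneg (φ p.1 + φ p.2))]

/-- The Picone-type inequality for the Laplacian part of the energy form. -/
lemma tsum_sq_div_mul_laplacian_le {b : X → X → ℝ} (hb : IsGraph b) {u : X → ℝ}
    (hu : MemF b u) (hpos : ∀ x, 0 < u x) {φ : X → ℝ} (hφ : FinSupp φ) :
    ∑' x, (∑' y, b x y * (u x - u y)) / u x * φ x ^ 2 ≤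
      (1 / 2) * ∑' p : X × X, b p.1 p.2 * (φ p.1 - φ p.2) ^ 2 := by
  set F : X × X → ℝ := fun p => b p.1 p.2 * (u p.1 - u p.2) * (φ p.1 ^ 2 / u p.1) with hFdef
  have hF : Summable F := by
    refine summable_prod_of_finite_support_left (s := Function.support φ) hφ
      (fun x hx y => ?_) fun x => (hu.summable_mul_sub hb x).mul_right (φ x ^ 2 / u x)
    simp [hFdef, Function.notMem_support.1 hx]
  have hF' : Summable fun p : X × X => F p.swap := (Equiv.prodComm X X).summable_iff.2 hF
  have hswap : ∑' p : X × X, F p.swap = ∑' p, F p := (Equiv.prodComm X X).tsum_eq F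
  have hlhs : ∑' x, (∑' y, b x y * (u x - u y)) / u x * φ x ^ 2 = ∑' p, F p := by
    rw [hF.tsum_prod]
    refine tsum_congr fun x => ?_
    simp only [hFdef, tsum_mul_right]
    ring
  have hle : ∑' p, (F p + F p.swap) ≤ ∑' p : X × X, b p.1 p.2 * (φ p.1 - φ p.2) ^ 2 := by
    refine (hF.add hF').tsum_le_tsum (fun p => ?_) (summable_energy hb hφ)
    calc F p + F p.swap
        = b p.1 p.2 * ((u p.1 - u p.2) * (φ p.1 ^ 2 / u p.1 - φ p.2 ^ 2 / u p.2)) := by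
          simp only [hFdef, Prod.fst_swap, Prod.snd_swap, hb.2.1 p.2 p.1]
          ring
      _ ≤ _ := mul_le_mul_of_nonneg_left
          (sub_mul_sq_div_sub_sq_div_le (hpos _) (hpos _) _ _) (hb.1 _ _)
  rw [hF.tsum_add hF', hswap] at hle
  rw [hlhs]
  linarith

/-- Easy direction of the Allegretto–Piepenbrink theorem. -/
theorem allegretto_piepenbrink_easy (b : X → X → ℝ) (q : X → ℝ) (hb : IsGraph b)
    (hconn : GraphConnected b) (m : X → ℝ) (hm : ∀ x, 0 < m x) (lam : ℝ)
    (u : X → ℝ) (hu : MemF b u) (hupos : ∀ x, 0 ≤ u x) (hune : u ≠ 0)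
    (hsuper : ∀ x, lam * m x * u x ≤ Hop b q u x) :
    ∀ φ : X → ℝ, FinSupp φ → lam * (∑' x, m x * φ x ^ 2) ≤ hform b q φ := by
  intro φ hφ
  have hpos := pos_of_supersolution hb hconn hu hupos hune hsuper
  set l : X → ℝ := fun x => (∑' y, b x y * (u x - u y)) / u x with hl
  calc lam * ∑' x, m x * φ x ^ 2
      = ∑' x, lam * m x * φ x ^ 2 := by simp only [mul_assoc, tsum_mul_left]
    _ ≤ ∑' x, (l x * φ x ^ 2 + q x * φ x ^ 2) := by
        refine (hφ.summable_mul_sq _).tsum_le_tsum (fun x => ?_)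
          ((hφ.summable_mul_sq _).add (hφ.summable_mul_sq _))
        rw [← add_mul]
        refine mul_le_mul_of_nonneg_right ?_ (sq_nonneg _)
        have h : l x + q x = Hop b q u x / u x := by
          have := (hpos x).ne'
          simp only [hl, Hop]
          field_simp
        rw [h, le_div_iff₀ (hpos x)]
        exact hsuper x
    _ = ∑' x, l x * φ x ^ 2 + ∑' x, q x * φ x ^ 2 :=
        (hφ.summable_mul_sq _).tsum_add (hφ.summable_mul_sq _)
    _ ≤ hform b q φ := add_le_add_left (tsum_sq_div_mul_laplacian_le hb hu hpos hφ) _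
end

section
/- Criticality via capacity: Let b be a connected graph over X and q : X → ℝ a potential such that h ≥ 0. Then h is critical in X if and only if cap_h({x}) = 0 for all x ∈ X. -/
open Filter Topology

variable {X : Type*}

lemma hform_const_mul (b : X → X → ℝ) (q : X → ℝ) (c : ℝ) (φ : X → ℝ) :
    hform b q (fun y => c * φ y) = c ^ 2 * hform b q φ := by
  have h₁ : (∑' p : X × X, b p.1 p.2 * (c * φ p.1 - c * φ p.2) ^ 2)
      = c ^ 2 * ∑' p : X × X, b p.1 p.2 * (φ p.1 - φ p.2) ^ 2 := by
    rw [← tsum_mul_left]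
    exact tsum_congr fun p => by ring
  have h₂ : (∑' x, q x * (c * φ x) ^ 2) = c ^ 2 * ∑' x, q x * φ x ^ 2 := by
    rw [← tsum_mul_left]
    exact tsum_congr fun x => by ring
  simp only [hform, h₁, h₂]
  ring

lemma FinSupp.const_mul {φ : X → ℝ} (hφ : FinSupp φ) (c : ℝ) : FinSupp fun y => c * φ y :=
  hφ.subset fun y hy hφy => hy (by simp [hφy])

/-- The singleton capacity is bounded below by any lower bound of the energies it minimizes. -/
lemma le_capH {b : X → X → ℝ} {q : X → ℝ} {x : X} {c : ℝ}
    (h : ∀ φ : X → ℝ, FinSupp φ → φ x = 1 → c ≤ hform b q φ) : c ≤ capH b q x := by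
  classical
  apply le_csInf
  · exact ⟨_, Pi.single x 1, (Set.finite_singleton x).subset Pi.support_single_subset,
      Pi.single_eq_same x 1, rfl⟩
  · rintro r ⟨φ, hφ, hx, rfl⟩
    exact h φ hφ hx

lemma capH_mul_sq_le_hform {b : X → X → ℝ} {q : X → ℝ}
    (hpos : ∀ φ : X → ℝ, FinSupp φ → 0 ≤ hform b q φ) (x : X) {φ : X → ℝ} (hφ : FinSupp φ) :
    capH b q x * φ x ^ 2 ≤ hform b q φ := by
  by_cases hx : φ x = 0
  · simpa [hx] using hpos φ hφ
  have hle : capH b q x ≤ hform b q fun y => (φ x)⁻¹ * φ y := by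
    refine csInf_le ⟨0, ?_⟩ ⟨_, hφ.const_mul _, inv_mul_cancel₀ hx, rfl⟩
    rintro r ⟨ψ, hψ, -, rfl⟩
    exact hpos ψ hψ
  rw [hform_const_mul, inv_pow] at hle
  rwa [← le_div_iff₀ (by positivity), div_eq_inv_mul]

lemma mul_sq_le_tsum {w φ : X → ℝ} (hw : ∀ x, 0 ≤ w x) (hφ : FinSupp φ) (x : X) :
    w x * φ x ^ 2 ≤ ∑' y, w y * φ y ^ 2 := by
  refine (summable_of_hasFiniteSupport (hφ.subset fun y hy hφy => hy ?_)).le_tsum x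
    fun y _ => mul_nonneg (hw y) (sq_nonneg _)
  simp [hφy]

/-- Criticality via capacity. -/
theorem criticality_iff_capacity_zero (b : X → X → ℝ) (q : X → ℝ) (hb : IsGraph b)
    (hconn : GraphConnected b)
    (hpos : ∀ φ : X → ℝ, FinSupp φ → 0 ≤ hform b q φ) :
    ¬ Subcritical b q ↔ ∀ x : X, capH b q x = 0 := by
  classical
  constructor
  · intro hcrit x
    by_contra hcap
    have hnonneg : 0 ≤ capH b q x := le_capH fun φ hφ _ => hpos φ hφ
    have hsingle : (0 : X → ℝ) ≤ Pi.single x (capH b q x) := Pi.single_nonneg.2 hnonneg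
    refine hcrit ⟨Pi.single x (capH b q x), hsingle,
      mt Pi.single_eq_zero_iff.1 hcap, fun φ hφ => ?_⟩
    rw [tsum_eq_single x fun y hy => by simp [hy], Pi.single_eq_same]
    exact capH_mul_sq_le_hform hpos x hφ
  · rintro hcap ⟨w, hw, hw₀, hle⟩
    obtain ⟨x, hx⟩ := Function.ne_iff.1 hw₀
    have hwx : w x ≤ capH b q x := le_capH fun φ hφ hφx => by
      simpa [hφx] using (mul_sq_le_tsum hw hφ x).trans (hle φ hφ)
    exact hx (le_antisymm (hwx.trans_eq (hcap x)) (hw x))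
end
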